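/- Let G be a finite simple graph with vertex set V, let b₀ ∈ V be a designated root, let Q ⊆ V \ {b₀} be a nonempty set of sources, let h be a natural number, and let c : V → ℝ≥0 be a cost function with c(v) = 0 for all v ∈ Q ∪ {b₀}. Assume that for every k ∈ Q there exists a path in G from k to b₀ with at most h + 1 edges. Then the minimum, over all families (Y_k)_{k ∈ Q} with Y_k ⊆ V \ {k, b₀}, |Y_k| ≤ h, and Y_k ∩ C ≠ ∅ for every node cut C for (k, b₀), of ∑_{j ∈ ⋃_{k ∈ Q} Y_k} c(j), is greater than or equal to the minimum, over all families of paths (p_k)_{k ∈ Q} where p_k is a path in G from k to b₀ with at most h + 1 edges, of ∑_{j ∈ ⋃_{k ∈ Q} I(p_k)} c(j), where I(p_k) denotes the set of internal vertices of p_k. -/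

import Mathlib

/-- A node cut for the pair `(s, t)`: a set of vertices avoiding `s` and `t` that meets
every path in `G` from `s` to `t`. -/
def IsNodeCut {V : Type*} (G : SimpleGraph V) (s t : V) (C : Set V) : Prop :=
  C ⊆ ({s, t} : Set V)ᶜ ∧ ∀ p : G.Walk s t, p.IsPath → ∃ v ∈ C, v ∈ p.support

/-- The internal vertices of a walk from `s` to `t`: its support minus the endpoints. -/
def internalVerts {V : Type*} {G : SimpleGraph V} {s t : V} (p : G.Walk s t) : Set V :=
  {v | v ∈ p.support} \ {s, t}

/-- A path between distinct vertices has one more edge than it has internal vertices. -/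
lemma ncard_internalVerts_add_one {V : Type*} {G : SimpleGraph V} {s t : V} {p : G.Walk s t}
    (hp : p.IsPath) (hst : s ≠ t) : (internalVerts p).ncard + 1 = p.length := by
  classical
  have hsub : ({s, t} : Set V) ⊆ {v | v ∈ p.support} := by
    rintro v (rfl | rfl)
    · exact p.start_mem_support
    · exact p.end_mem_support
  have hfin : ({v | v ∈ p.support} : Set V).Finite := p.support.finite_toSet
  have hcard : ({v | v ∈ p.support} : Set V).ncard = p.length + 1 := by
    rw [← SimpleGraph.Walk.length_support, ← List.toFinset_card_of_nodup hp.support_nodup,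
      ← Set.ncard_coe_finset, List.coe_toFinset]
  have hdiff := Set.ncard_sdiff_add_ncard_of_subset hsub hfin
  rw [Set.ncard_pair hst, hcard] at hdiff
  unfold internalVerts
  omega

/-- The internal vertices of a path meet every node cut for its endpoints. -/
lemma internalVerts_inter_nonempty {V : Type*} {G : SimpleGraph V} {s t : V} {p : G.Walk s t}
    (hp : p.IsPath) {C : Set V} (hC : IsNodeCut G s t C) : (internalVerts p ∩ C).Nonempty := by
  obtain ⟨v, hvC, hvp⟩ := hC.2 p hp
  exact ⟨v, ⟨hvp, hC.1 hvC⟩, hvC⟩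

/-- A set meeting every node cut contains the internal vertices of some path. -/
lemma exists_isPath_internalVerts_subset {V : Type*} {G : SimpleGraph V} {s t : V} {Y : Set V}
    (hY : ∀ C : Set V, IsNodeCut G s t C → (Y ∩ C).Nonempty) :
    ∃ p : G.Walk s t, p.IsPath ∧ internalVerts p ⊆ Y := by
  by_contra! hcon
  obtain ⟨v, hvY, -, hv⟩ := hY (({s, t} : Set V)ᶜ \ Y) ⟨Set.sdiff_subset, fun p hp => by
    obtain ⟨v, hv, hvY⟩ := Set.not_subset.1 (hcon p hp)
    exact ⟨v, ⟨hv.2, hvY⟩, hv.1⟩⟩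
  exact hv hvY

/-- Corollary (ilpcor2), graph content: the node-cut-based minimum (ILP optimum) is at
least the minimum cost over families of hop-feasible source-to-sink paths. -/
theorem stmt_14 {V : Type*} [Fintype V] (G : SimpleGraph V) (b₀ : V) (Q : Set V)
    (hQne : Q.Nonempty) (hQ : Q ⊆ ({b₀} : Set V)ᶜ) (h : ℕ) (c : V → NNReal)
    (hc : ∀ v ∈ Q ∪ {b₀}, c v = 0)
    (hfeas : ∀ k ∈ Q, ∃ p : G.Walk k b₀, p.IsPath ∧ p.length ≤ h + 1) :
    sInf {x : NNReal | ∃ Y : V → Set V,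
        (∀ k ∈ Q, Y k ⊆ ({k, b₀} : Set V)ᶜ ∧ (Y k).ncard ≤ h ∧
          ∀ C : Set V, IsNodeCut G k b₀ C → (Y k ∩ C).Nonempty) ∧
        x = ∑' j : (⋃ k ∈ Q, Y k), c j.1} ≥
    sInf {x : NNReal | ∃ P : (k : V) → k ∈ Q → G.Walk k b₀,
        (∀ (k : V) (hk : k ∈ Q), (P k hk).IsPath ∧ (P k hk).length ≤ h + 1) ∧
        x = ∑' j : (⋃ (k : V) (hk : k ∈ Q), internalVerts (P k hk)), c j.1} := by
  have hne : ∀ k ∈ Q, k ≠ b₀ := fun k hk => hQ hk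
  refine le_csInf ?_ ?_
  · choose P hP hlen using hfeas
    classical
    refine ⟨_, fun k => if hk : k ∈ Q then internalVerts (P k hk) else ∅, fun k hk => ?_, rfl⟩
    simp only [dif_pos hk]
    have hcard := ncard_internalVerts_add_one (hP k hk) (hne k hk)
    have hle := hlen k hk
    exact ⟨fun v hv => hv.2, by omega, fun C hC => internalVerts_inter_nonempty (hP k hk) hC⟩
  · rintro x ⟨Y, hY, rfl⟩
    choose P hP hsub using fun k hk => exists_isPath_internalVerts_subset (hY k hk).2.2
    refine csInf_le_of_le (OrderBot.bddBelow _) ⟨P, fun k hk => ⟨hP k hk, ?_⟩, rfl⟩ ?_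
    · have hcard := ncard_internalVerts_add_one (hP k hk) (hne k hk)
      have hle := Set.ncard_le_ncard (hsub k hk) (Set.toFinite _)
      have hYh := (hY k hk).2.1
      omega
    · have hU : (⋃ (k : V) (hk : k ∈ Q), internalVerts (P k hk)) ⊆ ⋃ k ∈ Q, Y k :=
        Set.iUnion₂_mono hsub
      exact Summable.tsum_le_tsum_of_inj (Set.inclusion hU) (Set.inclusion_injective hU)
        (fun _ _ => zero_le) (fun _ => le_rfl) (Summable.of_finite) (Summable.of_finite)
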